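/- For every integer d ≥ 1, every real s ≥ 0 and every p ∈ [1,∞], there is a constant C = C(d,s,p) such that ‖(−Δ_{ℤ^d})^s f‖_{ℓ^p(ℤ^d)} ≤ C ‖f‖_{ℓ^p(ℤ^d)} for all f ∈ ℓ¹(ℤ^d). -/

import Mathlib

open MeasureTheory Real
open scoped ENNReal NNReal

/-- The function `Sin(ξ) = (4 ∑_j sin²(π ξ_j))^{1/2}` on `ℝ^d`. -/
noncomputable def SinD (d : ℕ) (ξ : Fin d → ℝ) : ℝ :=
  Real.sqrt (4 * ∑ j, Real.sin (Real.pi * ξ j) ^ 2)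

/-- The torus `𝕋^d = [-1/2, 1/2]^d`. -/
noncomputable def Td (d : ℕ) : Set (Fin d → ℝ) :=
  Set.univ.pi fun _ => Set.Icc (-(1 : ℝ) / 2) (1 / 2)

/-- The Fourier transform of `f ∈ ℓ¹(ℤ^d)`. -/
noncomputable def Ftd (d : ℕ) (f : (Fin d → ℤ) → ℂ) (ξ : Fin d → ℝ) : ℂ :=
  ∑' n : Fin d → ℤ,
    f n * Complex.exp (2 * Real.pi * Complex.I * ∑ j, (n j : ℂ) * (ξ j : ℂ))

/-- The `ℓ^p(ℤ^d)` norm for `p ∈ [1,∞]`, valued in `ℝ≥0∞`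
(for `p = ∞` it is the supremum norm). -/
noncomputable def lpNE (d : ℕ) (p : ℝ≥0∞) (f : (Fin d → ℤ) → ℂ) : ℝ≥0∞ :=
  if p = ∞ then ⨆ n : Fin d → ℤ, (‖f n‖₊ : ℝ≥0∞)
  else (∑' n : Fin d → ℤ, (‖f n‖₊ : ℝ≥0∞) ^ p.toReal) ^ (1 / p.toReal)

/-- The fractional power of the discrete Laplacian on `ℤ^d`:
`(-Δ_{ℤ^d})^s f(n) = ∫_{𝕋^d} Sin(ξ)^{2s} 𝓕f(ξ) e^{-2πi n·ξ} dξ`. -/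
noncomputable def fracLapZ (d : ℕ) (s : ℝ) (f : (Fin d → ℤ) → ℂ)
    (n : Fin d → ℤ) : ℂ :=
  ∫ ξ in Td d,
    ((SinD d ξ ^ (2 * s) : ℝ) : ℂ) * Ftd d f ξ *
      Complex.exp (-(2 * Real.pi * Complex.I) * ∑ j, (n j : ℂ) * (ξ j : ℂ))

/-! ### The binomial series on the closed unit interval -/

theorem succ_mul_ringChoose_succ (s : ℝ) (k : ℕ) :
    ((k : ℝ) + 1) * Ring.choose s (k + 1) = (s - k) * Ring.choose s k := by
  have h1 := Ring.descPochhammer_eq_factorial_smul_choose s (k + 1)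
  have h2 := Ring.descPochhammer_eq_factorial_smul_choose s k
  rw [descPochhammer_succ_right, Polynomial.smeval_mul, h2, Nat.factorial_succ] at h1
  simp only [Polynomial.smeval_sub, Polynomial.smeval_X, Polynomial.smeval_natCast, nsmul_eq_mul,
    pow_one, pow_zero, mul_one] at h1
  have h3 : (k.factorial : ℝ) ≠ 0 := by positivity
  apply mul_left_cancel₀ h3
  push_cast at h1
  linear_combination -h1

theorem summable_abs_ringChoose {s : ℝ} (hs : 0 ≤ s) :
    Summable fun k : ℕ => |Ring.choose s k| := by
  rcases hs.eq_or_lt with rfl | hs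
  · refine summable_of_ne_finset_zero (s := {0}) fun k hk => ?_
    rw [Ring.choose_zero_pos ℝ (Nat.pos_of_ne_zero (by simpa using hk)), abs_zero]
  · obtain ⟨N, hN⟩ := exists_nat_ge s
    rw [← summable_nat_add_iff N]
    set a : ℕ → ℝ := fun k => |Ring.choose s (k + N)| with ha
    have hrec : ∀ k : ℕ, s * a k = (k + N : ℕ) * a k - (k + 1 + N : ℕ) * a (k + 1) := by
      intro k
      have h := congrArg abs (succ_mul_ringChoose_succ s (k + N))
      have hk : (0 : ℝ) ≤ k := k.cast_nonneg
      have hN' : (0 : ℝ) ≤ N := N.cast_nonneg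
      rw [abs_mul, abs_mul, abs_of_nonneg (by positivity : (0 : ℝ) ≤ (k + N : ℕ) + 1),
        abs_of_nonpos (by push_cast; linarith : s - (k + N : ℕ) ≤ 0)] at h
      simp only [ha, show k + 1 + N = k + N + 1 by ring]
      push_cast at h ⊢
      linarith
    refine summable_of_sum_range_le (c := (N * a 0) / s) (fun k => abs_nonneg _) fun n => ?_
    rw [le_div_iff₀ hs, mul_comm, Finset.mul_sum, Finset.sum_congr rfl fun k _ => hrec k,
      Finset.sum_range_sub' fun k : ℕ => ((k + N : ℕ) : ℝ) * a k]
    have : 0 ≤ ((n + N : ℕ) : ℝ) * a n := mul_nonneg (Nat.cast_nonneg _) (abs_nonneg _)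
    simp only [zero_add]
    linarith

theorem hasSum_ringChoose_mul_pow {s : ℝ} (hs : 0 ≤ s) {x : ℝ} (hx : |x| ≤ 1) :
    HasSum (fun k : ℕ => Ring.choose s k * x ^ k) ((1 + x) ^ s) := by
  have hbd : ∀ k : ℕ, ∀ y ∈ Set.Icc (-1 : ℝ) 1,
      ‖Ring.choose s k * y ^ k‖ ≤ |Ring.choose s k| := by
    intro k y hy
    rw [norm_mul, norm_pow]
    exact mul_le_of_le_one_right (abs_nonneg _) (pow_le_one₀ (abs_nonneg _) (abs_le.2 hy))
  have hcont : ContinuousOn (fun y : ℝ => ∑' k : ℕ, Ring.choose s k * y ^ k)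
      (Set.Icc (-1) 1) :=
    continuousOn_tsum (fun k => by fun_prop) (summable_abs_ringChoose hs) hbd
  have hcont' : ContinuousOn (fun y : ℝ => (1 + y) ^ s) (Set.Icc (-1) 1) :=
    ((Real.continuous_rpow_const hs).comp (by fun_prop : Continuous fun y : ℝ => 1 + y)).continuousOn
  have heq : Set.EqOn (fun y : ℝ => ∑' k : ℕ, Ring.choose s k * y ^ k)
      (fun y : ℝ => (1 + y) ^ s) (Set.Ioo (-1) 1) := by
    intro y hy
    have h := (Real.one_add_rpow_hasFPowerSeriesOnBall_zero (a := s)).hasSum (y := y)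
      (by simpa [enorm_eq_nnnorm, ← NNReal.coe_lt_coe] using abs_lt.2 hy)
    simp only [binomialSeries_apply, List.ofFn_const, List.prod_replicate, zero_add,
      smul_eq_mul] at h
    exact h.tsum_eq
  have hx' : x ∈ Set.Icc (-1 : ℝ) 1 := abs_le.1 hx
  have hval : ∑' k : ℕ, Ring.choose s k * x ^ k = (1 + x) ^ s :=
    heq.of_subset_closure hcont hcont' Set.Ioo_subset_Icc_self
    (by rw [closure_Ioo (by norm_num)]) hx'
  have hsum : Summable fun k : ℕ => Ring.choose s k * x ^ k :=
    Summable.of_norm_bounded (summable_abs_ringChoose hs) fun k => hbd k x hx'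
  exact hval ▸ hsum.hasSum

/-! ### Characters of the lattice and Fourier inversion -/

/-- The character `ξ ↦ e^{2πi n·ξ}`. -/
noncomputable def latticeChar {d : ℕ} (n : Fin d → ℤ) (ξ : Fin d → ℝ) : ℂ :=
  Complex.exp (2 * Real.pi * Complex.I * ∑ j, (n j : ℂ) * (ξ j : ℂ))

section

variable {d : ℕ}

theorem latticeChar_add (m n : Fin d → ℤ) (ξ : Fin d → ℝ) :
    latticeChar (m + n) ξ = latticeChar m ξ * latticeChar n ξ := by
  rw [latticeChar, latticeChar, latticeChar, ← Complex.exp_add, ← mul_add,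
    ← Finset.sum_add_distrib]
  simp [add_mul]

theorem latticeChar_zero (ξ : Fin d → ℝ) : latticeChar 0 ξ = 1 := by simp [latticeChar]

theorem latticeChar_neg (n : Fin d → ℤ) (ξ : Fin d → ℝ) :
    latticeChar (-n) ξ =
      Complex.exp (-(2 * Real.pi * Complex.I) * ∑ j, (n j : ℂ) * (ξ j : ℂ)) := by
  simp [latticeChar]

theorem norm_latticeChar (n : Fin d → ℤ) (ξ : Fin d → ℝ) : ‖latticeChar n ξ‖ = 1 := by
  have : 2 * Real.pi * Complex.I * ∑ j, (n j : ℂ) * (ξ j : ℂ)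
      = ((2 * Real.pi * ∑ j, (n j : ℝ) * ξ j : ℝ) : ℂ) * Complex.I := by
    push_cast; ring
  rw [latticeChar, this, Complex.norm_exp_ofReal_mul_I]

theorem continuous_latticeChar (n : Fin d → ℤ) : Continuous (latticeChar n) := by
  unfold latticeChar; fun_prop

theorem latticeChar_single_add_neg (j : Fin d) (ξ : Fin d → ℝ) :
    latticeChar (Pi.single j 1) ξ + latticeChar (-Pi.single j 1) ξ =
      2 * (Real.cos (2 * Real.pi * ξ j) : ℂ) := by
  have h : ∑ i, ((Pi.single j 1 : Fin d → ℤ) i : ℂ) * (ξ i : ℂ) = ξ j := by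
    rw [Finset.sum_eq_single j] <;> simp +contextual
  rw [latticeChar_neg, latticeChar, h, Complex.ofReal_cos, Complex.two_cos]
  push_cast
  congr 2 <;> ring

theorem volume_restrict_Td (d : ℕ) : (volume : Measure (Fin d → ℝ)).restrict (Td d) =
    Measure.pi fun _ => (volume : Measure ℝ).restrict (Set.Icc (-(1 : ℝ) / 2) (1 / 2)) := by
  rw [Td, volume_pi, Measure.restrict_pi_pi]

instance isProbabilityMeasure_restrict_Td (d : ℕ) :
    IsProbabilityMeasure ((volume : Measure (Fin d → ℝ)).restrict (Td d)) := by
  have : IsProbabilityMeasure ((volume : Measure ℝ).restrict (Set.Icc (-(1 : ℝ) / 2) (1 / 2))) :=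
    ⟨by norm_num⟩
  rw [volume_restrict_Td]
  infer_instance

theorem integral_exp_int_mul (m : ℤ) :
    ∫ x in Set.Icc (-(1 : ℝ) / 2) (1 / 2), Complex.exp (2 * Real.pi * Complex.I * (m * (x : ℂ))) =
      if m = 0 then 1 else 0 := by
  split_ifs with hm
  · norm_num [hm, Measure.real]
  · rw [integral_Icc_eq_integral_Ioc, ← intervalIntegral.integral_of_le (by norm_num)]
    have hc : 2 * Real.pi * Complex.I * m ≠ 0 := by
      simp [hm, Real.pi_ne_zero]
    simp_rw [← mul_assoc]
    rw [integral_exp_mul_complex hc, div_eq_zero_iff, sub_eq_zero]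
    left
    rw [Complex.exp_eq_exp_iff_exists_int]
    exact ⟨m, by push_cast; ring⟩

theorem integral_latticeChar (n : Fin d → ℤ) :
    ∫ ξ in Td d, latticeChar n ξ = if n = 0 then 1 else 0 := by
  simp_rw [latticeChar, Finset.mul_sum, Complex.exp_sum]
  rw [volume_restrict_Td, integral_fintype_prod_eq_prod
    (f := fun j (x : ℝ) => Complex.exp (2 * Real.pi * Complex.I * ((n j : ℂ) * (x : ℂ))))]
  simp_rw [integral_exp_int_mul]
  rw [Finset.prod_ite_zero]
  simp [funext_iff]

theorem hasSum_Ftd {f : (Fin d → ℤ) → ℂ} (hf : Summable fun n => ‖f n‖) (ξ : Fin d → ℝ) :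
    HasSum (fun n => f n * latticeChar n ξ) (Ftd d f ξ) :=
  (Summable.of_norm (by simpa [norm_latticeChar] using hf)).hasSum

theorem continuous_Ftd {f : (Fin d → ℤ) → ℂ} (hf : Summable fun n => ‖f n‖) :
    Continuous (Ftd d f) :=
  continuous_tsum (fun n => continuous_const.mul (continuous_latticeChar n)) hf
    fun n ξ => by
      change ‖f n * latticeChar n ξ‖ ≤ _
      simp [norm_latticeChar]

theorem norm_Ftd_le {f : (Fin d → ℤ) → ℂ} (hf : Summable fun n => ‖f n‖) (ξ : Fin d → ℝ) :
    ‖Ftd d f ξ‖ ≤ ∑' n, ‖f n‖ := by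
  rw [← (hasSum_Ftd hf ξ).tsum_eq]
  exact tsum_of_norm_bounded hf.hasSum fun n => by simp [norm_latticeChar]

theorem integral_Ftd_mul_latticeChar_neg {f : (Fin d → ℤ) → ℂ} (hf : Summable fun n => ‖f n‖)
    (n : Fin d → ℤ) : ∫ ξ in Td d, Ftd d f ξ * latticeChar (-n) ξ = f n := by
  have hsum := hasSum_integral_of_dominated_convergence
    (μ := (volume : Measure (Fin d → ℝ)).restrict (Td d))
    (F := fun m ξ => f m * latticeChar m ξ * latticeChar (-n) ξ)
    (f := fun ξ => Ftd d f ξ * latticeChar (-n) ξ) (fun m _ => ‖f m‖)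
    (fun m => ((continuous_const.mul (continuous_latticeChar m)).mul
      (continuous_latticeChar (-n))).aestronglyMeasurable)
    (fun m => .of_forall fun ξ => by simp [norm_latticeChar])
    (.of_forall fun _ => hf) (integrable_const _)
    (.of_forall fun ξ => (hasSum_Ftd hf ξ).mul_right _)
  refine hsum.unique ?_
  have heq : ∀ m, ∫ ξ in Td d, f m * latticeChar m ξ * latticeChar (-n) ξ =
      if m = n then f n else 0 := by
    intro m
    simp_rw [mul_assoc, ← latticeChar_add]
    rw [integral_const_mul, integral_latticeChar, ← sub_eq_add_neg]
    by_cases h : m = n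
    · simp [h]
    · simp [h, sub_eq_zero]
  simp_rw [heq]
  exact hasSum_ite_eq n (f n)

/-! ### The nearest-neighbour averaging operator -/

/-- The average of `f` over the `2d` nearest neighbours of a lattice point. -/
noncomputable def neighborAvg (f : (Fin d → ℤ) → ℂ) : (Fin d → ℤ) → ℂ :=
  (2 * d : ℂ)⁻¹ • ∑ j : Fin d, ((fun n => f (n + Pi.single j 1)) + fun n => f (n - Pi.single j 1))

/-- The Fourier multiplier of `neighborAvg`. -/
noncomputable def cosAvg (ξ : Fin d → ℝ) : ℝ := (d : ℝ)⁻¹ * ∑ j, Real.cos (2 * Real.pi * ξ j)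

theorem abs_cosAvg_le_one (ξ : Fin d → ℝ) : |cosAvg ξ| ≤ 1 := by
  have h : |∑ j, Real.cos (2 * Real.pi * ξ j)| ≤ d := by
    refine (Finset.abs_sum_le_sum_abs _ _).trans ?_
    refine (Finset.sum_le_sum fun j _ => Real.abs_cos_le_one _).trans ?_
    simp
  rw [cosAvg, abs_mul, abs_inv, Nat.abs_cast]
  exact inv_mul_le_one_of_le₀ h (Nat.cast_nonneg d)

theorem continuous_cosAvg : Continuous (cosAvg (d := d)) := by
  unfold cosAvg; fun_prop

theorem SinD_rpow (hd : 1 ≤ d) (s : ℝ) (ξ : Fin d → ℝ) :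
    SinD d ξ ^ (2 * s) = (2 * d) ^ s * (1 - cosAvg ξ) ^ s := by
  have hd' : (d : ℝ) ≠ 0 := by positivity
  have hsq : 4 * ∑ j, Real.sin (Real.pi * ξ j) ^ 2 = 2 * d * (1 - cosAvg ξ) := by
    have h : ∀ j, 4 * Real.sin (Real.pi * ξ j) ^ 2 = 2 - 2 * Real.cos (2 * Real.pi * ξ j) := by
      intro j
      rw [mul_assoc 2 Real.pi, Real.cos_two_mul, Real.sin_sq]
      ring
    rw [Finset.mul_sum, Finset.sum_congr rfl fun j _ => h j, Finset.sum_sub_distrib,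
      ← Finset.mul_sum, cosAvg]
    simp only [Finset.sum_const, Finset.card_univ, Fintype.card_fin, nsmul_eq_mul]
    field_simp
  have hnn : 0 ≤ 1 - cosAvg ξ := by linarith [(abs_le.1 (abs_cosAvg_le_one ξ)).2]
  rw [SinD, hsq, ← Real.mul_rpow (by positivity) hnn, Real.sqrt_eq_rpow,
    ← Real.rpow_mul (by positivity)]
  congr 1
  ring

theorem neighborAvg_apply (f : (Fin d → ℤ) → ℂ) (n : Fin d → ℤ) :
    neighborAvg f n = (2 * d : ℂ)⁻¹ *
      ∑ j : Fin d, (f (n + Pi.single j 1) + f (n + -Pi.single j 1)) := by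
  simp [neighborAvg, sub_eq_add_neg]

theorem summable_norm_neighborAvg {f : (Fin d → ℤ) → ℂ} (hf : Summable fun n => ‖f n‖) :
    Summable fun n => ‖neighborAvg f n‖ := by
  have hshift : ∀ v : Fin d → ℤ, Summable fun n => f (n + v) := fun v =>
    hf.of_norm.comp_injective (add_left_injective v)
  simp_rw [neighborAvg_apply]
  exact ((summable_sum fun j _ => (hshift _).add (hshift _)).mul_left _).norm

theorem Ftd_neighborAvg (hd : 1 ≤ d) {f : (Fin d → ℤ) → ℂ} (hf : Summable fun n => ‖f n‖)
    (ξ : Fin d → ℝ) : Ftd d (neighborAvg f) ξ = cosAvg ξ * Ftd d f ξ := by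
  have hshift : ∀ v : Fin d → ℤ, HasSum (fun n => f (n + v) * latticeChar n ξ)
      (latticeChar (-v) ξ * Ftd d f ξ) := by
    intro v
    have h := ((Equiv.addRight v).hasSum_iff.2 (hasSum_Ftd hf ξ)).mul_left (latticeChar (-v) ξ)
    refine h.congr_fun fun n => ?_
    simp only [Function.comp_apply, Equiv.coe_addRight]
    rw [mul_left_comm, ← latticeChar_add, neg_add_cancel_comm_assoc]
  have hd' : (d : ℂ) ≠ 0 := by exact_mod_cast (by omega : d ≠ 0)
  refine (hasSum_Ftd (summable_norm_neighborAvg hf) ξ).unique ?_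
  have h := (hasSum_sum (s := Finset.univ) fun j _ =>
    (hshift (Pi.single j 1)).add (hshift (-Pi.single j 1))).mul_left (2 * d : ℂ)⁻¹
  have hval : (2 * d : ℂ)⁻¹ * ∑ j : Fin d, (latticeChar (-Pi.single j 1) ξ * Ftd d f ξ +
      latticeChar (- -Pi.single j 1) ξ * Ftd d f ξ) = cosAvg ξ * Ftd d f ξ := by
    have h2 : ∀ j : Fin d, latticeChar (-Pi.single j 1) ξ * Ftd d f ξ +
        latticeChar (- -Pi.single j 1) ξ * Ftd d f ξ =
          2 * (Real.cos (2 * Real.pi * ξ j) : ℂ) * Ftd d f ξ := by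
      intro j
      rw [neg_neg, ← latticeChar_single_add_neg]
      ring
    rw [Finset.sum_congr rfl fun j _ => h2 j, ← Finset.sum_mul, ← Finset.mul_sum, cosAvg]
    push_cast
    field_simp
  rw [hval] at h
  refine h.congr_fun fun n => ?_
  rw [neighborAvg_apply, mul_assoc, Finset.sum_mul]
  simp_rw [add_mul]

theorem summable_norm_iterate_neighborAvg {f : (Fin d → ℤ) → ℂ} (hf : Summable fun n => ‖f n‖)
    (k : ℕ) : Summable fun n => ‖neighborAvg^[k] f n‖ := by
  induction k with
  | zero => exact hf
  | succ k ih =>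
    rw [Function.iterate_succ_apply']
    exact summable_norm_neighborAvg ih

theorem Ftd_iterate_neighborAvg (hd : 1 ≤ d) {f : (Fin d → ℤ) → ℂ}
    (hf : Summable fun n => ‖f n‖) (k : ℕ) (ξ : Fin d → ℝ) :
    Ftd d (neighborAvg^[k] f) ξ = (cosAvg ξ : ℂ) ^ k * Ftd d f ξ := by
  induction k with
  | zero => simp
  | succ k ih =>
    rw [Function.iterate_succ_apply', Ftd_neighborAvg hd (summable_norm_iterate_neighborAvg hf k),
      ih, pow_succ', mul_assoc]

/-- The fractional Laplacian is a binomial series in the averaging operator. -/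
theorem hasSum_fracLapZ (hd : 1 ≤ d) {s : ℝ} (hs : 0 ≤ s) {f : (Fin d → ℤ) → ℂ}
    (hf : Summable fun n => ‖f n‖) (n : Fin d → ℤ) :
    HasSum (fun k : ℕ => (((2 * d) ^ s * ((-1) ^ k * Ring.choose s k) : ℝ) : ℂ) *
      neighborAvg^[k] f n) (fracLapZ d s f n) := by
  set c : ℕ → ℝ := fun k => (2 * d) ^ s * ((-1) ^ k * Ring.choose s k) with hc
  have hcabs : ∀ k, |c k| = (2 * d) ^ s * |Ring.choose s k| := by
    intro k
    rw [hc, abs_mul, abs_mul, abs_pow, abs_neg, abs_one, one_pow, one_mul,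
      abs_of_nonneg (by positivity)]
  have hcsum : Summable fun k => |c k| := by
    simp_rw [hcabs]
    exact (summable_abs_ringChoose hs).mul_left _
  have hsymb : ∀ ξ : Fin d → ℝ, HasSum (fun k => (c k : ℂ) * (cosAvg ξ : ℂ) ^ k)
      ((SinD d ξ ^ (2 * s) : ℝ) : ℂ) := by
    intro ξ
    have h := (hasSum_ringChoose_mul_pow hs (x := -cosAvg ξ)
      (by rw [abs_neg]; exact abs_cosAvg_le_one ξ)).mul_left ((2 * d : ℝ) ^ s)
    rw [← sub_eq_add_neg, ← SinD_rpow hd] at h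
    have h' := Complex.hasSum_ofReal.2 h
    refine h'.congr_fun fun k => ?_
    rw [neg_pow]
    simp only [hc]
    push_cast
    ring
  have hsum := hasSum_integral_of_dominated_convergence
    (μ := (volume : Measure (Fin d → ℝ)).restrict (Td d))
    (F := fun k ξ => (c k : ℂ) * (cosAvg ξ : ℂ) ^ k * Ftd d f ξ * latticeChar (-n) ξ)
    (f := fun ξ => ((SinD d ξ ^ (2 * s) : ℝ) : ℂ) * Ftd d f ξ * latticeChar (-n) ξ)
    (fun k _ => |c k| * ∑' m, ‖f m‖)
    (fun k => (((continuous_const.mul ((Complex.continuous_ofReal.comp continuous_cosAvg).pow k)).mul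
      (continuous_Ftd hf)).mul (continuous_latticeChar (-n))).aestronglyMeasurable)
    (fun k => .of_forall fun ξ => by
      rw [norm_mul, norm_latticeChar, mul_one, norm_mul]
      refine mul_le_mul ?_ (norm_Ftd_le hf ξ) (norm_nonneg _) (abs_nonneg _)
      rw [norm_mul, norm_pow, Complex.norm_real, Complex.norm_real]
      exact mul_le_of_le_one_right (abs_nonneg _)
        (pow_le_one₀ (abs_nonneg _) (abs_cosAvg_le_one ξ)))
    (.of_forall fun _ => hcsum.mul_right _) (integrable_const _)
    (.of_forall fun ξ => ((hsymb ξ).mul_right _).mul_right _)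
  have hlim : fracLapZ d s f n =
      ∫ ξ in Td d, ((SinD d ξ ^ (2 * s) : ℝ) : ℂ) * Ftd d f ξ * latticeChar (-n) ξ := by
    simp_rw [latticeChar_neg]
    rfl
  rw [hlim]
  refine hsum.congr_fun fun k => ?_
  rw [← integral_Ftd_mul_latticeChar_neg (summable_norm_iterate_neighborAvg hf k) n,
    ← integral_const_mul]
  simp_rw [Ftd_iterate_neighborAvg hd hf, hc, mul_assoc]

/-! ### `ℓ^p` bounds -/

theorem lpNE_eq_eLpNorm {p : ℝ≥0∞} (hp : 1 ≤ p) (f : (Fin d → ℤ) → ℂ) :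
    lpNE d p f = eLpNorm f p Measure.count := by
  rw [lpNE]
  split_ifs with h
  · rw [h, eLpNorm_exponent_top, eLpNormEssSup_count]
    rfl
  · rw [eLpNorm_eq_lintegral_rpow_enorm_toReal (by positivity) h, lintegral_count]
    rfl

theorem eLpNorm_comp_equiv_count (e : (Fin d → ℤ) ≃ (Fin d → ℤ)) (p : ℝ≥0∞)
    (f : (Fin d → ℤ) → ℂ) :
    eLpNorm (fun n => f (e n)) p Measure.count = eLpNorm f p Measure.count :=
  eLpNorm_comp_measurePreserving (measurable_of_countable f).aestronglyMeasurable
    ⟨measurable_of_countable e, by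
      ext t ht
      rw [Measure.map_apply (measurable_of_countable e) ht, Measure.count_apply ht,
        Measure.count_apply (measurable_of_countable e ht),
        Set.encard_preimage_of_bijective e.bijective]⟩

theorem eLpNorm_neighborAvg_le (hd : 1 ≤ d) {p : ℝ≥0∞} (hp : 1 ≤ p) (f : (Fin d → ℤ) → ℂ) :
    eLpNorm (neighborAvg f) p Measure.count ≤ eLpNorm f p Measure.count := by
  have hmeas : ∀ g : (Fin d → ℤ) → ℂ, AEStronglyMeasurable g Measure.count :=
    fun g => (measurable_of_countable g).aestronglyMeasurable
  have hsum : eLpNorm (∑ j : Fin d, ((fun n : Fin d → ℤ => f (n + Pi.single j 1)) +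
      fun n => f (n - Pi.single j 1))) p Measure.count ≤ 2 * d * eLpNorm f p Measure.count := by
    refine (eLpNorm_sum_le (fun j _ => hmeas _) hp).trans ?_
    refine (Finset.sum_le_sum fun j _ => eLpNorm_add_le (hmeas _) (hmeas _) hp).trans ?_
    have h1 := fun j : Fin d => eLpNorm_comp_equiv_count (Equiv.addRight (Pi.single j 1)) p f
    have h2 := fun j : Fin d => eLpNorm_comp_equiv_count (Equiv.subRight (Pi.single j 1)) p f
    simp only [Equiv.coe_addRight, Equiv.subRight_apply] at h1 h2
    simp only [h1, h2, ← two_mul, Finset.sum_const, Finset.card_univ, Fintype.card_fin,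
      nsmul_eq_mul]
    rw [mul_left_comm, mul_assoc]
  rw [neighborAvg]
  refine eLpNorm_const_smul_le.trans ((mul_le_mul_right hsum _).trans ?_)
  have hd' : (2 * d : ℂ) ≠ 0 := by
    exact_mod_cast (by omega : 2 * d ≠ 0)
  have hn : ‖(2 * d : ℂ)‖ₑ = 2 * d := by
    rw [← ofReal_norm]
    simp [ENNReal.ofReal_mul]
  rw [enorm_inv hd', hn, ← mul_assoc, ENNReal.inv_mul_cancel, one_mul]
  · exact_mod_cast (by omega : 2 * d ≠ 0)
  · exact_mod_cast ENNReal.natCast_ne_top (2 * d)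

theorem eLpNorm_iterate_neighborAvg_le (hd : 1 ≤ d) {p : ℝ≥0∞} (hp : 1 ≤ p)
    (f : (Fin d → ℤ) → ℂ) (k : ℕ) :
    eLpNorm (neighborAvg^[k] f) p Measure.count ≤ eLpNorm f p Measure.count := by
  induction k with
  | zero => exact le_rfl
  | succ k ih =>
    rw [Function.iterate_succ_apply']
    exact (eLpNorm_neighborAvg_le hd hp _).trans ih

/-- A pointwise convergent series `∑ c k • g k` with `∑ |c k| < ∞` and uniformly bounded
`‖g k‖_p` obeys the countable triangle inequality. -/
theorem eLpNorm_le_of_hasSum {α : Type*} [MeasurableSpace α] {μ : Measure α} {p : ℝ≥0∞}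
    (hp : 1 ≤ p) {c : ℕ → ℝ} (hc : Summable fun k => |c k|) {g : ℕ → α → ℂ} {h : α → ℂ}
    (hg : ∀ k, AEStronglyMeasurable (g k) μ) {B : ℝ≥0∞} (hB : ∀ k, eLpNorm (g k) p μ ≤ B)
    (hh : ∀ x, HasSum (fun k => (c k : ℂ) * g k x) (h x)) :
    eLpNorm h p μ ≤ ENNReal.ofReal (∑' k, |c k|) * B := by
  refine (Lp.eLpNorm_lim_le_liminf_eLpNorm
    (f := fun N => ∑ k ∈ Finset.range N, (c k : ℂ) • g k)
    (fun N => Finset.aestronglyMeasurable_sum _ fun k _ => (hg k).const_smul _) h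
    (.of_forall fun x => by simpa using (hh x).tendsto_sum_nat)).trans ?_
  refine Filter.liminf_le_of_le (by isBoundedDefault) fun b hb => ?_
  obtain ⟨N, hN⟩ := hb.exists
  refine hN.trans ((eLpNorm_sum_le (fun k _ => (hg k).const_smul _) hp).trans ?_)
  calc ∑ k ∈ Finset.range N, eLpNorm ((c k : ℂ) • g k) p μ
      ≤ ∑ k ∈ Finset.range N, ENNReal.ofReal |c k| * B := by
        refine Finset.sum_le_sum fun k _ => eLpNorm_const_smul_le.trans ?_
        rw [← ofReal_norm, Complex.norm_real, Real.norm_eq_abs]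
        gcongr
        exact hB k
    _ = ENNReal.ofReal (∑ k ∈ Finset.range N, |c k|) * B := by
        rw [← Finset.sum_mul, ENNReal.ofReal_sum_of_nonneg fun k _ => abs_nonneg _]
    _ ≤ ENNReal.ofReal (∑' k, |c k|) * B := by
        gcongr
        exact hc.sum_le_tsum _ fun k _ => abs_nonneg _

end

/-- **`ℓ^p` boundedness of the fractional discrete Laplacian:** for every `s ≥ 0` and
`p ∈ [1,∞]` there is `C = C(d,s,p)` with
`‖(-Δ_{ℤ^d})^s f‖_{ℓ^p} ≤ C ‖f‖_{ℓ^p}` for all `f ∈ ℓ¹(ℤ^d)`. -/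
theorem stmt7 (d : ℕ) (hd : 1 ≤ d) (s : ℝ) (hs : 0 ≤ s) (p : ℝ≥0∞) (hp : 1 ≤ p) :
    ∃ C : ℝ, 0 < C ∧
      ∀ f : (Fin d → ℤ) → ℂ, Summable (fun n => ‖f n‖) →
        lpNE d p (fracLapZ d s f) ≤ ENNReal.ofReal C * lpNE d p f := by
  set c : ℕ → ℝ := fun k => (2 * d) ^ s * ((-1) ^ k * Ring.choose s k) with hc
  have hcsum : Summable fun k => |c k| := by
    simpa [hc, abs_mul] using (summable_abs_ringChoose hs).mul_left |(2 * d : ℝ) ^ s|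
  refine ⟨∑' k, |c k| + 1, by positivity, fun f hf => ?_⟩
  rw [lpNE_eq_eLpNorm hp, lpNE_eq_eLpNorm hp]
  refine (eLpNorm_le_of_hasSum hp hcsum
    (fun k => (measurable_of_countable _).aestronglyMeasurable)
    (eLpNorm_iterate_neighborAvg_le hd hp f) (hasSum_fracLapZ hd hs hf)).trans ?_
  gcongr
  linarith
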